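/- arXiv:1301.5585 — 2 statements merged into one kernel-verified Lean document; each statement's English description precedes it below -/
import Mathlib

section
/- There exists a regular language L over a two-letter alphabet such that no minimal NFA accepting L is atomic, i.e., every NFA accepting L with the minimal possible number of states has a state whose right language is not a union of positive atoms of L. -/
/-! Basic definitions: left quotients, atoms, and operations on finite automata. -/

/-- The left quotient of a language `L` by a word `w`: `w⁻¹L = {x | w ++ x ∈ L}`. -/
def leftQuot {α : Type} (L : Language α) (w : List α) : Language α := {x | w ++ x ∈ L}

/-- The set of all left quotients of `L`. -/
def quots {α : Type} (L : Language α) : Set (Language α) := {K | ∃ w : List α, K = leftQuot L w}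

/-- `A` is an atom of `L`: a non-empty intersection `K̃_0 ∩ ⋯ ∩ K̃_{n−1}` where each `K̃_i` is a
quotient `K_i` of `L` or its complement (`S` is the set of uncomplemented quotients, so a word is
in the intersection iff it belongs exactly to the quotients in `S`). -/
def IsAtomOf {α : Type} (L A : Language α) : Prop :=
  (∃ x, x ∈ A) ∧ ∃ S : Set (Language α), S ⊆ quots L ∧
    A = {x | ∀ K ∈ quots L, (x ∈ K ↔ K ∈ S)}

/-- A positive atom: at least one term of its defining intersection is uncomplemented,
equivalently the atom is contained in some quotient of `L`. -/
def IsPositiveAtomOf {α : Type} (L A : Language α) : Prop :=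
  IsAtomOf L A ∧ ∃ K ∈ quots L, ∀ x ∈ A, x ∈ K

namespace NFA

/-- The right language of a state `q`: words accepted starting from `q`. -/
def rightLang {α σ : Type} (M : NFA α σ) (q : σ) : Language α :=
  {w | ∃ p ∈ M.accept, p ∈ M.evalFrom {q} w}

/-- The left language of a state `q`: words leading from the initial states to `q`. -/
def leftLang {α σ : Type} (M : NFA α σ) (q : σ) : Language α :=
  {w | q ∈ M.eval w}

/-- An NFA is trim if every state has a non-empty left language and right language. -/
def IsTrim {α σ : Type} (M : NFA α σ) : Prop :=
  ∀ q, (∃ w, w ∈ M.leftLang q) ∧ (∃ w, w ∈ M.rightLang q)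

/-- An NFA is reduced if distinct states have distinct right languages. -/
def IsReduced {α σ : Type} (M : NFA α σ) : Prop :=
  ∀ q p, M.rightLang q = M.rightLang p → q = p

/-- An NFA is atomic if the right language of every state is a union of positive atoms of the
accepted language. -/
def IsAtomic {α σ : Type} (M : NFA α σ) : Prop :=
  ∀ q, ∃ 𝒜 : Set (Language α), (∀ A ∈ 𝒜, IsPositiveAtomOf M.accepts A) ∧
    M.rightLang q = {w | ∃ A ∈ 𝒜, w ∈ A}

/-- Reversal of an NFA: interchange initial and final states and reverse all transitions. -/
def rev {α σ : Type} (M : NFA α σ) : NFA α σ :=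
  ⟨fun q a => {p | q ∈ M.step p a}, M.accept, M.start⟩

/-- States of the determinization of an NFA: the subsets of states reachable from the initial
subset. -/
def detStates {α σ : Type} (M : NFA α σ) : Type := {S : Set σ // ∃ w, M.eval w = S}

instance {α σ : Type} [Finite σ] (M : NFA α σ) : Finite M.detStates :=
  Subtype.finite

/-- Determinization of an NFA by the subset construction, keeping only the subsets reachable
from the initial subset. -/
def det {α σ : Type} (M : NFA α σ) : DFA α M.detStates where
  step S a := ⟨M.stepSet S.1 a, by
    obtain ⟨w, hw⟩ := S.2
    exact ⟨w ++ [a], by rw [NFA.eval_append_singleton, hw]⟩⟩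
  start := ⟨M.start, [], rfl⟩
  accept := {S | ∃ p ∈ M.accept, p ∈ S.1}

end NFA

/-- Reversal of a DFA, yielding an NFA. -/
def DFA.rev {α σ : Type} (M : DFA α σ) : NFA α σ :=
  ⟨fun q a => {p | M.step p a = q}, M.accept, {M.start}⟩

/-- A DFA is minimal if no DFA accepting the same language has fewer states. -/
def DFA.IsMinimal {α σ : Type} (M : DFA α σ) : Prop :=
  ∀ (σ' : Type) (_ : Finite σ') (M' : DFA α σ'), M'.accepts = M.accepts →
    Nat.card σ ≤ Nat.card σ'

/-- Words lying in the same left quotients of `L` lie in the same atoms of `L`. -/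
theorem IsAtomOf.mem_iff_mem {α : Type} {L A : Language α} (hA : IsAtomOf L A) {x y : List α}
    (h : ∀ w, w ++ x ∈ L ↔ w ++ y ∈ L) : x ∈ A ↔ y ∈ A := by
  obtain ⟨-, S, -, rfl⟩ := hA
  refine forall₂_congr fun K hK => ?_
  obtain ⟨w, rfl⟩ := hK
  exact iff_congr (h w) Iff.rfl

namespace NFA

theorem mem_acceptsFrom_iff_exists_rightLang {α σ : Type} (M : NFA α σ) (S : Set σ)
    (w : List α) : w ∈ M.acceptsFrom S ↔ ∃ q ∈ S, w ∈ M.rightLang q := by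
  simp only [mem_acceptsFrom, M.mem_evalFrom_iff_exists (S := S)]
  constructor
  · rintro ⟨p, hp, q, hq, h⟩
    exact ⟨q, hq, p, hp, h⟩
  · rintro ⟨q, hq, p, hp, h⟩
    exact ⟨p, hp, q, hq, h⟩

theorem mem_accepts_iff_exists_rightLang {α σ : Type} (M : NFA α σ) (w : List α) :
    w ∈ M.accepts ↔ ∃ q ∈ M.start, w ∈ M.rightLang q :=
  M.mem_acceptsFrom_iff_exists_rightLang M.start w

theorem nil_mem_rightLang {α σ : Type} (M : NFA α σ) (q : σ) :
    [] ∈ M.rightLang q ↔ q ∈ M.accept := by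
  change (∃ p ∈ M.accept, p ∈ M.evalFrom {q} []) ↔ _
  simp

theorem cons_mem_rightLang {α σ : Type} (M : NFA α σ) (q : σ) (a : α) (w : List α) :
    a :: w ∈ M.rightLang q ↔ ∃ p ∈ M.step q a, w ∈ M.rightLang p := by
  rw [← mem_acceptsFrom_iff_exists_rightLang, ← stepSet_singleton, ← cons_mem_acceptsFrom]
  rfl

/-- In an atomic NFA, words lying in the same left quotients of the accepted language lie in the
same right languages. -/
theorem IsAtomic.mem_rightLang_iff {α σ : Type} {M : NFA α σ} (hM : M.IsAtomic) (q : σ)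
    {x y : List α} (h : ∀ w, w ++ x ∈ M.accepts ↔ w ++ y ∈ M.accepts) :
    x ∈ M.rightLang q ↔ y ∈ M.rightLang q := by
  obtain ⟨𝒜, h𝒜, hq⟩ := hM q
  rw [hq]
  exact exists_congr fun A => and_congr_right fun hA => (h𝒜 A hA).1.mem_iff_mem h

end NFA

/-- Right-to-left transition function on the four atoms of the witness language: the words `a :: w`
with `w` in the atom `c` lie in the atom `prependAtom a c`. -/
def prependAtom (a : Fin 2) : Fin 4 → Fin 4 :=
  ![![1, 2, 3, 3], ![0, 0, 2, 3]] a

/-- The atom of the witness language containing a given word. -/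
def atomIndex (w : List (Fin 2)) : Fin 4 :=
  w.foldr prependAtom 0

/-- A regular language with a three-state NFA but no atomic NFA of that size. -/
def witnessLang : Language (Fin 2) := {w | atomIndex w ≠ 2}

theorem mem_witnessLang (w : List (Fin 2)) : w ∈ witnessLang ↔ atomIndex w ≠ 2 := Iff.rfl

/-- Transition function of a three-state NFA accepting `witnessLang`. -/
def witnessStep (q : Fin 3) (a : Fin 2) : Finset (Fin 3) :=
  ![![{0, 1}, {0}], ![{0, 2}, ∅], ![∅, {1, 2}]] q a

/-- A three-state NFA accepting `witnessLang`. -/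
def witnessNFA : NFA (Fin 2) (Fin 3) where
  step q a := witnessStep q a
  start := {1, 2}
  accept := {2}

/-- The states of `witnessNFA` from which a given word is accepted. -/
def acceptingStates (w : List (Fin 2)) : Finset (Fin 3) :=
  w.foldr (fun a T => Finset.univ.filter fun q => ∃ p ∈ witnessStep q a, p ∈ T) {2}

theorem mem_acceptingStates (w : List (Fin 2)) (q : Fin 3) :
    q ∈ acceptingStates w ↔ w ∈ witnessNFA.rightLang q := by
  induction w generalizing q with
  | nil => simp [acceptingStates, NFA.nil_mem_rightLang, witnessNFA]
  | cons a w ih =>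
    rw [NFA.cons_mem_rightLang]
    simp only [← ih]
    simp [acceptingStates, witnessNFA]

theorem acceptingStates_atomIndex (w : List (Fin 2)) :
    (acceptingStates w, atomIndex w) ∈
      [({2}, 0), ({1}, 1), ({0}, 2), ({0, 1}, 3), (({0, 2} : Finset (Fin 3)), (3 : Fin 4))] := by
  induction w with
  | nil => simp [acceptingStates, atomIndex]
  | cons a w ih =>
    simp only [acceptingStates, atomIndex, List.foldr_cons] at ih ⊢
    generalize List.foldr _ _ w = T at ih ⊢
    generalize List.foldr _ _ w = c at ih ⊢
    revert a
    simp only [List.mem_cons, Prod.mk.injEq, List.not_mem_nil, or_false] at ih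
    rcases ih with ⟨rfl, rfl⟩ | ⟨rfl, rfl⟩ | ⟨rfl, rfl⟩ | ⟨rfl, rfl⟩ | ⟨rfl, rfl⟩ <;> decide

theorem witnessNFA_accepts : witnessNFA.accepts = witnessLang := by
  ext w
  have h := acceptingStates_atomIndex w
  rw [NFA.mem_accepts_iff_exists_rightLang, mem_witnessLang]
  simp only [← mem_acceptingStates]
  simp only [List.mem_cons, Prod.mk.injEq, List.not_mem_nil, or_false] at h
  rcases h with ⟨hT, hc⟩ | ⟨hT, hc⟩ | ⟨hT, hc⟩ | ⟨hT, hc⟩ | ⟨hT, hc⟩ <;>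
    simp [hT, hc, witnessNFA]

theorem witnessLang_isRegular : witnessLang.IsRegular :=
  ⟨Set (Fin 3), inferInstance, witnessNFA.toDFA, by
    rw [NFA.toDFA_correct, witnessNFA_accepts]⟩

theorem append_mem_witnessLang_congr {x y : List (Fin 2)} (h : atomIndex x = atomIndex y)
    (w : List (Fin 2)) : w ++ x ∈ witnessLang ↔ w ++ y ∈ witnessLang := by
  simp only [mem_witnessLang]
  unfold atomIndex at h ⊢
  rw [List.foldr_append, List.foldr_append, h]

theorem atomIndex_replicate (c : Fin 4) : atomIndex (List.replicate c 0) = c := by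
  revert c
  decide

/-- `X` is the union of some of the sets in `𝒴`. -/
def IsUnionOf (𝒴 : List (Finset (Fin 4))) (X : Finset (Fin 4)) : Prop :=
  ∀ c ∈ X, ∃ Y ∈ 𝒴, c ∈ Y ∧ Y ⊆ X

instance (𝒴 : List (Finset (Fin 4))) (X : Finset (Fin 4)) : Decidable (IsUnionOf 𝒴 X) :=
  inferInstanceAs (Decidable (∀ c ∈ X, ∃ Y ∈ 𝒴, c ∈ Y ∧ Y ⊆ X))

/-- Three unions of atoms cannot generate the witness language and their own left quotients by
letters. -/
theorem not_isUnionOf_triple : ∀ A B C : Finset (Fin 4), IsUnionOf [A, B, C] {0, 1, 3} →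
    ¬ ∀ Y ∈ [A, B, C], ∀ a, IsUnionOf [A, B, C] {c | prependAtom a c ∈ Y} := by
  decide +kernel

theorem NFA.IsAtomic.three_lt_card {σ : Type} [Finite σ] {M : NFA (Fin 2) σ} (hM : M.IsAtomic)
    (hL : M.accepts = witnessLang) : 3 < Nat.card σ := by
  classical
  by_contra! hcard
  have : Fintype σ := Fintype.ofFinite σ
  have hne : Nonempty σ := by
    have h : [] ∈ M.accepts := by
      rw [hL, mem_witnessLang]
      decide
    obtain ⟨q, -⟩ := (M.mem_accepts_iff_exists_rightLang []).1 h
    exact ⟨q⟩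
  obtain ⟨g, hg⟩ : ∃ g : Fin 3 → σ, Function.Surjective g := by
    obtain ⟨e⟩ : Nonempty (σ ↪ Fin 3) :=
      Function.Embedding.nonempty_of_card_le (by simpa [Nat.card_eq_fintype_card] using hcard)
    exact ⟨Function.invFun e, Function.invFun_surjective e.injective⟩
  set S : σ → Finset (Fin 4) := fun q => {c | List.replicate c 0 ∈ M.rightLang q} with hS
  have mem_S : ∀ q w, atomIndex w ∈ S q ↔ w ∈ M.rightLang q := by
    intro q w
    rw [hS, Finset.mem_filter_univ]
    refine hM.mem_rightLang_iff q fun v => ?_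
    rw [hL]
    exact append_mem_witnessLang_congr (atomIndex_replicate _) v
  have mem_list : ∀ q, S q ∈ [S (g 0), S (g 1), S (g 2)] := by
    intro q
    obtain ⟨i, rfl⟩ := hg q
    fin_cases i <;> simp
  have mem_start : ∀ c, c ≠ 2 ↔ ∃ q ∈ M.start, c ∈ S q := by
    intro c
    rw [← atomIndex_replicate c, ← mem_witnessLang, ← hL, M.mem_accepts_iff_exists_rightLang]
    simp only [mem_S]
  have mem_step : ∀ q a c, prependAtom a c ∈ S q ↔ ∃ p ∈ M.step q a, c ∈ S p := by
    intro q a c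
    rw [← atomIndex_replicate c]
    simp only [mem_S]
    rw [← M.cons_mem_rightLang, ← mem_S]
    rfl
  refine not_isUnionOf_triple (S (g 0)) (S (g 1)) (S (g 2)) ?_ ?_
  · intro c hc
    obtain ⟨q, hq, hcq⟩ := (mem_start c).1 (by rintro rfl; revert hc; decide)
    refine ⟨S q, mem_list q, hcq, fun d hd => ?_⟩
    have key : ∀ d : Fin 4, d ≠ 2 → d ∈ ({0, 1, 3} : Finset (Fin 4)) := by decide
    exact key d ((mem_start d).2 ⟨q, hq, hd⟩)
  · have key : ∀ q a, IsUnionOf [S (g 0), S (g 1), S (g 2)] {c | prependAtom a c ∈ S q} := by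
      intro q a c hc
      obtain ⟨p, hp, hcp⟩ := (mem_step q a c).1 ((Finset.mem_filter_univ c).1 hc)
      exact ⟨S p, mem_list p, hcp, fun d hd =>
        (Finset.mem_filter_univ d).2 ((mem_step q a d).2 ⟨p, hp, hd⟩)⟩
    simpa only [List.forall_mem_cons, List.not_mem_nil, false_imp_iff, implies_true, and_true]
      using ⟨key (g 0), key (g 1), key (g 2)⟩

/-- There is a regular language `L` over a two-letter alphabet such that no
minimal NFA accepting `L` is atomic: every NFA accepting `L` with the minimal possible number
of states fails to be atomic. -/
theorem exists_language_no_minimal_nfa_atomic :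
    ∃ L : Language (Fin 2), L.IsRegular ∧
      ∀ (σ : Type) (_ : Finite σ) (M : NFA (Fin 2) σ), M.accepts = L →
        (∀ (σ' : Type) (_ : Finite σ') (M' : NFA (Fin 2) σ'), M'.accepts = L →
          Nat.card σ ≤ Nat.card σ') →
        ¬ M.IsAtomic := by
  exact ⟨witnessLang, witnessLang_isRegular, fun σ _ M hL hmin hM =>
    (hM.three_lt_card hL).not_ge <| by
      simpa using hmin (Fin 3) inferInstance witnessNFA witnessNFA_accepts⟩
end

section
/- Let L over Σ = {a,b} be the language accepted by the 9-state DFA D with states 0,…,8, initial state 0, final states {2,5,7}, and transitions δ(0,a)=1, δ(0,b)=2, δ(1,a)=3, δ(1,b)=4, δ(2,a)=5, δ(2,b)=4, δ(3,a)=3, δ(3,b)=1, δ(4,a)=6, δ(4,b)=2, δ(5,a)=7, δ(5,b)=2, δ(6,a)=3, δ(6,b)=8, δ(7,a)=7, δ(7,b)=7, δ(8,a)=6, δ(8,b)=7. Then there is an NFA with 4 states accepting L, but every atomic NFA accepting L has at least 5 states; consequently no minimal NFA of L is atomic. -/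
/-- The transition table of the 9-state DFA (letters: `0 = a`, `1 = b`). -/
def d17step : Fin 9 → Fin 2 → Fin 9 :=
  ![![1, 2], ![3, 4], ![5, 4], ![3, 1], ![6, 2], ![7, 2], ![3, 8], ![7, 7], ![6, 7]]

/-- The 9-state DFA with initial state `0` and final states `{2, 5, 7}`. -/
def D17 : DFA (Fin 2) (Fin 9) := ⟨d17step, 0, {2, 5, 7}⟩

section

variable {α σ : Type}

theorem NFA.mem_rightLang_cons (M : NFA α σ) (q : σ) (a : α) (x : List α) :
    a :: x ∈ M.rightLang q ↔ ∃ p ∈ M.step q a, x ∈ M.rightLang p := by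
  change (∃ r ∈ M.accept, r ∈ M.evalFrom {q} (a :: x)) ↔
    ∃ p ∈ M.step q a, ∃ r ∈ M.accept, r ∈ M.evalFrom {p} x
  simp only [NFA.evalFrom_cons, NFA.stepSet_singleton]
  simp only [M.mem_evalFrom_iff_exists (S := M.step q a)]
  tauto

theorem NFA.append_mem_accepts (M : NFA α σ) (w x : List α) :
    w ++ x ∈ M.accepts ↔ ∃ q ∈ M.eval w, x ∈ M.rightLang q := by
  change (∃ r ∈ M.accept, r ∈ M.evalFrom M.start (w ++ x)) ↔
    ∃ p ∈ M.eval w, ∃ r ∈ M.accept, r ∈ M.evalFrom {p} x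
  simp only [NFA.evalFrom_append, M.mem_evalFrom_iff_exists (S := M.evalFrom M.start w), NFA.eval]
  tauto

theorem IsAtomOf.mem_of_mem {L A : Language α} (hA : IsAtomOf L A) {x y : List α}
    (hxy : ∀ w, w ++ x ∈ L ↔ w ++ y ∈ L) (hx : x ∈ A) : y ∈ A := by
  obtain ⟨-, S, -, rfl⟩ := hA
  rintro _ ⟨w, rfl⟩
  exact (hxy w).symm.trans (hx _ ⟨w, rfl⟩)

theorem NFA.IsAtomic.mem_rightLang_of_mem {M : NFA α σ} (hM : M.IsAtomic) {x y : List α}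
    (hxy : ∀ w, w ++ x ∈ M.accepts ↔ w ++ y ∈ M.accepts) {q : σ} (hx : x ∈ M.rightLang q) :
    y ∈ M.rightLang q := by
  obtain ⟨𝒜, h𝒜, hq⟩ := hM q
  rw [hq] at hx ⊢
  obtain ⟨A, hA, hxA⟩ := hx
  exact ⟨A, hA, (h𝒜 A hA).1.mem_of_mem hxy hxA⟩

theorem DFA.append_mem_accepts (M : DFA α σ) (w x : List α) :
    w ++ x ∈ M.accepts ↔ M.evalFrom (M.eval w) x ∈ M.accept := by
  rw [DFA.mem_accepts, DFA.eval, DFA.evalFrom_of_append]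

/-- An NFA accepts the language of a DFA as soon as its subset construction simulates the DFA. -/
theorem NFA.accepts_eq_of_simulation {τ : Type} (M : NFA α σ) (D : DFA α τ) (φ : τ → Set σ)
    (hstart : M.start = φ D.start) (hstep : ∀ t a, M.stepSet (φ t) a = φ (D.step t a))
    (haccept : ∀ t, (∃ q ∈ M.accept, q ∈ φ t) ↔ t ∈ D.accept) : M.accepts = D.accepts := by
  have key : ∀ (w : List α) (t : τ), M.evalFrom (φ t) w = φ (D.evalFrom t w) := by
    intro w
    induction w with
    | nil => intro t; rfl
    | cons a w ih => intro t; rw [NFA.evalFrom_cons, hstep, ih, DFA.evalFrom_cons]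
  ext w
  change (∃ q ∈ M.accept, q ∈ M.evalFrom M.start w) ↔ D.evalFrom D.start w ∈ D.accept
  rw [hstart, key, haccept]

end

/-- The transition table of a 4-state NFA accepting the language of `D17`. -/
def n17step : Fin 4 → Fin 2 → Finset (Fin 4) :=
  ![![{0, 2, 3}, ∅], ![{2}, {2, 3}], ![{2}, {1}], ![{1}, {0, 1}]]

/-- A 4-state NFA accepting the language of `D17`. -/
def N17 : NFA (Fin 2) (Fin 4) := ⟨fun q a => n17step q a, {3}, {0}⟩

/-- The subsets of states of `N17` simulating the states of `D17`. -/
def n17subset : Fin 9 → Finset (Fin 4) :=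
  ![{3}, {1}, {0, 1}, {2}, {2, 3}, {0, 2, 3}, {1, 2}, {0, 1, 2, 3}, {1, 2, 3}]

theorem N17_accepts : N17.accepts = D17.accepts := by
  refine N17.accepts_eq_of_simulation D17 (fun t => n17subset t) ?_ ?_ ?_
  · simp [N17, D17, n17subset]
  · have h : ∀ t a p, (∃ q ∈ n17subset t, p ∈ n17step q a) ↔ p ∈ n17subset (d17step t a) := by
      decide
    intro t a
    ext p
    simpa [NFA.mem_stepSet, N17, D17] using h t a p
  · have h : ∀ t, (0 ∈ n17subset t) ↔ (t = 2 ∨ t = 5 ∨ t = 7) := by decide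
    intro t
    simpa [N17, D17] using h t

/-- Whether `D17` accepts a word from a given state. -/
def d17acceptsFrom (t : Fin 9) (x : List (Fin 2)) : Bool :=
  decide (x.foldl d17step t ∈ ({2, 5, 7} : Finset (Fin 9)))

theorem D17_append_mem_accepts (w x : List (Fin 2)) :
    w ++ x ∈ D17.accepts ↔ d17acceptsFrom (D17.eval w) x = true := by
  simp [DFA.append_mem_accepts, d17acceptsFrom, D17, DFA.evalFrom]

theorem eq_or_eq_or_eq_or_eq_of_card_le_four {σ : Type} [Finite σ] (hσ : Nat.card σ ≤ 4)
    {p q r s : σ} (hpq : p ≠ q) (hpr : p ≠ r) (hps : p ≠ s) (hqr : q ≠ r) (hqs : q ≠ s)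
    (hrs : r ≠ s) (t : σ) : t = p ∨ t = q ∨ t = r ∨ t = s := by
  classical
  have := Fintype.ofFinite σ
  have hcard : ({p, q, r, s} : Finset σ).card = 4 := by
    simp [Finset.card_insert_of_notMem, *]
  have huniv : ({p, q, r, s} : Finset σ) = Finset.univ :=
    Finset.eq_univ_of_card _ <| le_antisymm (Finset.card_le_univ _) <| by
      rw [hcard, ← Nat.card_eq_fintype_card]; exact hσ
  have ht := Finset.mem_univ t
  rw [← huniv] at ht
  simpa using ht

theorem D17_five_le_card {σ : Type} [Finite σ] (M : NFA (Fin 2) σ)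
    (hL : M.accepts = D17.accepts) (hM : M.IsAtomic) : 5 ≤ Nat.card σ := by
  by_contra! hσ
  have cover : ∀ w x, d17acceptsFrom (D17.eval w) x = true →
      ∃ q ∈ M.eval w, x ∈ M.rightLang q := fun w x h => by
    rwa [← NFA.append_mem_accepts, hL, D17_append_mem_accepts]
  have sound : ∀ {w q}, q ∈ M.eval w → ∀ x, d17acceptsFrom (D17.eval w) x = false →
      x ∉ M.rightLang q := fun {w q} hq x h hx => by
    have := (M.append_mem_accepts w x).2 ⟨q, hq, hx⟩
    rw [hL, D17_append_mem_accepts, h] at this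
    cases this
  have atomic : ∀ x y, (∀ t, d17acceptsFrom t x = d17acceptsFrom t y) →
      ∀ {q}, x ∈ M.rightLang q → y ∈ M.rightLang q := fun x y h {q} =>
    hM.mem_rightLang_of_mem fun w => by
      rw [hL, D17_append_mem_accepts, D17_append_mem_accepts, h]
  obtain ⟨p, hp, hp_b⟩ := cover [] [1] (by decide)
  obtain ⟨q, hq, hq_bb⟩ := cover [0] [1, 1] (by decide)
  obtain ⟨r, hr, hr_nil⟩ := cover [1] [] (by decide)
  obtain ⟨s, hs, hs_bbb⟩ := cover [0, 0] [1, 1, 1] (by decide)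
  have all := eq_or_eq_or_eq_or_eq_of_card_le_four (by omega)
    (by rintro rfl; exact sound hq _ (by decide) hp_b : p ≠ q)
    (by rintro rfl; exact sound hr _ (by decide) hp_b : p ≠ r)
    (by rintro rfl; exact sound hs _ (by decide) hp_b : p ≠ s)
    (by rintro rfl; exact sound hq _ (by decide) hr_nil : q ≠ r)
    (by rintro rfl; exact sound hs _ (by decide) hq_bb : q ≠ s)
    (by rintro rfl; exact sound hs _ (by decide) hr_nil : r ≠ s)
  have hr' : r ∈ M.eval [1, 0] := by
    obtain ⟨t, ht, ht_nil⟩ := cover [1, 0] [] (by decide)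
    obtain rfl | rfl | rfl | rfl := all t
    · exact absurd ht_nil (sound hp _ (by decide))
    · exact absurd ht_nil (sound hq _ (by decide))
    · exact ht
    · exact absurd ht_nil (sound hs _ (by decide))
  have hs_abbb : [0, 1, 1, 1] ∈ M.rightLang s := by
    obtain ⟨t, ht, ht_abbb⟩ := cover [0, 0] [0, 1, 1, 1] (by decide)
    obtain rfl | rfl | rfl | rfl := all t
    · exact absurd hp_b (sound ht _ (by decide))
    · exact absurd hq_bb (sound ht _ (by decide))
    · exact absurd hr_nil (sound ht _ (by decide))
    · exact ht_abbb
  have hp_aabbb : [0, 0, 1, 1, 1] ∈ M.rightLang p := by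
    obtain ⟨t, ht, ht_aabbb⟩ := cover [] [0, 0, 1, 1, 1] (by decide)
    obtain rfl | rfl | rfl | rfl := all t
    · exact ht_aabbb
    · exact absurd hq_bb (sound ht _ (by decide))
    · exact absurd hr_nil (sound ht _ (by decide))
    · exact absurd hs_abbb (sound ht _ (by decide))
  have hp_step : p ∈ M.step r 0 := by
    obtain ⟨t, ht, ht_b⟩ :=
      (M.mem_rightLang_cons r 0 [1]).1 (atomic [] [0, 1] (by decide) hr_nil)
    obtain rfl | rfl | rfl | rfl := all t
    · exact ht
    · exact absurd ht_b (sound hq _ (by decide))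
    · exact absurd ht_b (sound hr _ (by decide))
    · exact absurd ht_b (sound hs _ (by decide))
  obtain ⟨t, ht, -⟩ := (M.mem_rightLang_cons r 1 [0, 0, 1, 1, 1]).1 <|
    atomic [0, 0, 0, 1, 1, 1] _ (by decide) ((M.mem_rightLang_cons r 0 _).2 ⟨p, hp_step, hp_aabbb⟩)
  have step_b : ∀ {x}, x ∈ M.rightLang t → 1 :: x ∈ M.rightLang r := fun hx =>
    (M.mem_rightLang_cons r 1 _).2 ⟨t, ht, hx⟩
  obtain rfl | rfl | rfl | rfl := all t
  · exact sound hr' _ (by decide) (step_b hp_b)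
  · exact sound hr _ (by decide) (step_b hq_bb)
  · exact sound hr _ (by decide) (step_b hr_nil)
  · exact sound hr' _ (by decide) (step_b hs_bbb)

/-- For the language `L` accepted by the 9-state DFA `D17`, there is an NFA
with 4 states accepting `L`, but every atomic NFA accepting `L` has at least 5 states; hence no
minimal NFA of `L` is atomic. -/
theorem d17_no_minimal_atomic :
    (∃ M : NFA (Fin 2) (Fin 4), M.accepts = D17.accepts) ∧
    (∀ (σ : Type) (_ : Finite σ) (M : NFA (Fin 2) σ), M.accepts = D17.accepts →
      M.IsAtomic → 5 ≤ Nat.card σ) ∧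
    (∀ (σ : Type) (_ : Finite σ) (M : NFA (Fin 2) σ), M.accepts = D17.accepts →
      (∀ (σ' : Type) (_ : Finite σ') (M' : NFA (Fin 2) σ'), M'.accepts = D17.accepts →
        Nat.card σ ≤ Nat.card σ') →
      ¬ M.IsAtomic) := by
  refine ⟨⟨N17, N17_accepts⟩, fun σ _ M hL hM => D17_five_le_card M hL hM, ?_⟩
  intro σ _ M hL hmin hM
  have h₁ := D17_five_le_card M hL hM
  have h₂ := hmin (Fin 4) inferInstance N17 N17_accepts
  rw [Nat.card_fin] at h₂
  omega
end
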